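/- arXiv:2503.12103 — 2 statements merged into one kernel-verified Lean document; each statement's English description precedes it below -/
import Mathlib

section
/- For every λ > 0, every q > 0 and every r ∈ (0,1), the following identity holds (all sums and integrals converging absolutely): ∑_{k=0}^∞ ∫₀^∞ (e^{−qy} r^{k+1} − r) · y e^{−λy} (λy)^k/(k+1)! ν(dy) + (σ²λ/2)(r² − r) + (ψ(λ)/λ)(1 − r) − σ² q r = (ψ(q + λ(1−r)) − ψ(q + λ) + ψ(λ))/λ. (This identifies the series form of the discrete branching mechanism Ψ_d of the intertwined two-type process in the case λ ≥ ρ with its closed form.) -/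
open MeasureTheory Set

/-- Branching mechanism without killing. -/
noncomputable def psi (σ γ : ℝ) (ν : Measure ℝ) (q : ℝ) : ℝ :=
  σ ^ 2 / 2 * q ^ 2 - γ * q +
    ∫ y in Ioi (0 : ℝ),
      (Real.exp (-q * y) - 1 + (if 0 < y ∧ y < 1 then q * y else 0)) ∂ν

lemma exp_neg_le_one_sub_add_sq {x : ℝ} (hx : 0 ≤ x) : Real.exp (-x) ≤ 1 - x + x ^ 2 := by
  rw [Real.exp_neg]
  refine (inv_anti₀ (by linarith) (Real.add_one_le_exp x)).trans ?_
  rw [inv_le_iff_one_le_mul₀ (by linarith)]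
  nlinarith [pow_nonneg hx 3]

lemma integrableOn_psi_integrand {ν : Measure ℝ}
    (hν : IntegrableOn (fun y => min 1 (y ^ 2)) (Ioi 0) ν) {a : ℝ} (ha : 0 ≤ a) :
    IntegrableOn (fun y =>
      Real.exp (-a * y) - 1 + (if 0 < y ∧ y < 1 then a * y else 0)) (Ioi 0) ν := by
  refine (hν.const_mul (a ^ 2 + 1)).mono' ?_ ?_
  · have hm : MeasurableSet {y : ℝ | 0 < y ∧ y < 1} := measurableSet_Ioo
    exact ((by fun_prop : Measurable fun y : ℝ => Real.exp (-a * y) - 1).add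
      (Measurable.ite hm (by fun_prop) measurable_const)).aestronglyMeasurable
  · filter_upwards [self_mem_ae_restrict (measurableSet_Ioi (a := (0 : ℝ)))] with y hy
    have hy0 : 0 < y := hy
    have hay : 0 ≤ a * y := by positivity
    rw [Real.norm_eq_abs, neg_mul]
    split_ifs with h
    · have h1 := Real.add_one_le_exp (-(a * y))
      have h2 := exp_neg_le_one_sub_add_sq hay
      rw [min_eq_right (by nlinarith [h.2]), abs_of_nonneg (by linarith)]
      nlinarith [sq_nonneg y]
    · have h1 : 1 ≤ y := by
        by_contra hlt
        exact h ⟨hy0, not_le.mp hlt⟩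
      have h2 : Real.exp (-(a * y)) ≤ 1 := Real.exp_le_one_iff.mpr (by linarith)
      rw [min_eq_left (by nlinarith), abs_of_nonpos (by linarith)]
      nlinarith [Real.exp_pos (-(a * y)), sq_nonneg a]

/-- A nonnegative series of measurable functions with integrable sum may be integrated
term by term. -/
lemma hasSum_integral_of_nonneg {α : Type*} [MeasurableSpace α] {μ : Measure α}
    {g : ℕ → α → ℝ} {G : α → ℝ} (hgm : ∀ k, AEStronglyMeasurable (g k) μ)
    (hg : ∀ᵐ x ∂μ, ∀ k, 0 ≤ g k x) (hsum : ∀ᵐ x ∂μ, HasSum (fun k => g k x) (G x))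
    (hG : Integrable G μ) :
    (∀ k, Integrable (g k) μ) ∧ HasSum (fun k => ∫ x, g k x ∂μ) (∫ x, G x ∂μ) := by
  have hint : ∀ k, Integrable (g k) μ := fun k => by
    refine hG.mono' (hgm k) ?_
    filter_upwards [hg, hsum] with x hx hs
    rw [Real.norm_of_nonneg (hx k)]
    exact le_hasSum hs k fun j _ => hx j
  refine ⟨hint, ?_⟩
  have hnorm : ∀ k, ∫ x, ‖g k x‖ ∂μ = ∫ x, g k x ∂μ := fun k => by
    refine integral_congr_ae ?_
    filter_upwards [hg] with x hx
    exact Real.norm_of_nonneg (hx k)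
  have hsummable : Summable fun k => ∫ x, g k x ∂μ := by
    refine summable_of_sum_le (c := ∫ x, G x ∂μ)
      (fun k => integral_nonneg_of_ae (hg.mono fun x hx => hx k)) fun s => ?_
    rw [← integral_finsetSum s fun k _ => hint k]
    refine integral_mono_ae (integrable_finsetSum s fun k _ => hint k) hG ?_
    filter_upwards [hg, hsum] with x hx hs
    exact sum_le_hasSum s (fun k _ => hx k) hs
  have h := hasSum_integral_of_summable_integral_norm hint (by simpa only [hnorm] using hsummable)
  rwa [integral_congr_ae (hsum.mono fun x hx => hx.tsum_eq)] at h

lemma hasSum_pow_succ_div_factorial_succ (x : ℝ) :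
    HasSum (fun k : ℕ => x ^ (k + 1) / ((k + 1).factorial : ℝ)) (Real.exp x - 1) := by
  have h : HasSum (fun k : ℕ => x ^ k / (k.factorial : ℝ)) (Real.exp x) := by
    rw [Real.exp_eq_exp_ℝ]
    exact NormedSpace.expSeries_div_hasSum_exp x
  simpa using (hasSum_nat_add_iff' 1).mpr h

/-- Pointwise sum of the series defining the jump part of `Ψ_d`. -/
lemma hasSum_jump_integrand {lam : ℝ} (hlam : lam ≠ 0) (q r y : ℝ) :
    HasSum (fun k : ℕ => (r - Real.exp (-q * y) * r ^ (k + 1)) *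
        (y * Real.exp (-lam * y) * (lam * y) ^ k / (Nat.factorial (k + 1) : ℝ)))
      ((r - r * Real.exp (-lam * y) - Real.exp (-(q + lam * (1 - r)) * y)
        + Real.exp (-(q + lam) * y)) / lam) := by
  have h1 := (hasSum_pow_succ_div_factorial_succ (lam * y)).mul_left
    (r * Real.exp (-lam * y) / lam)
  have h2 := (hasSum_pow_succ_div_factorial_succ (r * (lam * y))).mul_left
    (Real.exp (-q * y) * Real.exp (-lam * y) / lam)
  have e1 : Real.exp (-(q + lam * (1 - r)) * y)
        = Real.exp (-q * y) * Real.exp (-lam * y) * Real.exp (r * (lam * y)) := by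
      rw [← Real.exp_add, ← Real.exp_add]; ring_nf
  have e2 : Real.exp (-(q + lam) * y) = Real.exp (-q * y) * Real.exp (-lam * y) := by
      rw [← Real.exp_add]; ring_nf
  have e3 : Real.exp (-lam * y) * Real.exp (lam * y) = 1 := by
      rw [← Real.exp_add]; simp
  have hval : (r - r * Real.exp (-lam * y) - Real.exp (-(q + lam * (1 - r)) * y)
      + Real.exp (-(q + lam) * y)) / lam
      = r * Real.exp (-lam * y) / lam * (Real.exp (lam * y) - 1)
        - Real.exp (-q * y) * Real.exp (-lam * y) / lam * (Real.exp (r * (lam * y)) - 1) := by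
    rw [e1, e2]
    linear_combination (-r / lam) * e3
  rw [hval]
  refine (h1.sub h2).congr_fun fun k => ?_
  have := Nat.factorial_ne_zero (k + 1)
  rw [mul_pow r, pow_succ (lam * y)]
  field_simp

/-- Series form of the discrete branching mechanism `Ψ_d` in the case `λ ≥ ρ` equals its
closed form `(ψ(q+λ(1−r)) − ψ(q+λ) + ψ(λ))/λ`, all sums and integrals converging
absolutely. -/
theorem PsiD_series_eq_closed_form_lam_ge_rho
    (σ γ : ℝ) (hσ : 0 ≤ σ) (ν : Measure ℝ)
    (hν : IntegrableOn (fun y => min 1 (y ^ 2)) (Ioi 0) ν)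
    (lam q r : ℝ) (hlam : 0 < lam) (hq : 0 < q) (hr : r ∈ Ioo (0 : ℝ) 1) :
    (∀ k : ℕ, IntegrableOn (fun y =>
        (Real.exp (-q * y) * r ^ (k + 1) - r) *
          (y * Real.exp (-lam * y) * (lam * y) ^ k / (Nat.factorial (k + 1) : ℝ)))
        (Ioi 0) ν) ∧
    Summable (fun k : ℕ => ∫ y in Ioi (0 : ℝ),
        |Real.exp (-q * y) * r ^ (k + 1) - r| *
          (y * Real.exp (-lam * y) * (lam * y) ^ k / (Nat.factorial (k + 1) : ℝ)) ∂ν) ∧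
    (∀ a ∈ ({q + lam * (1 - r), q + lam, lam} : Set ℝ),
      IntegrableOn (fun y =>
        Real.exp (-a * y) - 1 + (if 0 < y ∧ y < 1 then a * y else 0)) (Ioi 0) ν) ∧
    (∑' k : ℕ, ∫ y in Ioi (0 : ℝ),
        (Real.exp (-q * y) * r ^ (k + 1) - r) *
          (y * Real.exp (-lam * y) * (lam * y) ^ k / (Nat.factorial (k + 1) : ℝ)) ∂ν)
      + σ ^ 2 * lam / 2 * (r ^ 2 - r) + psi σ γ ν lam / lam * (1 - r) - σ ^ 2 * q * r
      = (psi σ γ ν (q + lam * (1 - r)) - psi σ γ ν (q + lam) + psi σ γ ν lam) / lam := by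
  obtain ⟨hr0, hr1⟩ := hr
  have hA : ∀ a ∈ ({q + lam * (1 - r), q + lam, lam} : Set ℝ),
      IntegrableOn (fun y =>
        Real.exp (-a * y) - 1 + (if 0 < y ∧ y < 1 then a * y else 0)) (Ioi 0) ν := by
    intro a ha
    refine integrableOn_psi_integrand hν ?_
    have : 0 < lam * (1 - r) := mul_pos hlam (by linarith)
    rcases ha with rfl | rfl | rfl <;> linarith
  have h1 := hA (q + lam * (1 - r)) (by simp)
  have h2 := hA (q + lam) (by simp)
  have h3 := hA lam (by simp)
  have hpos : ∀ y ∈ Ioi (0 : ℝ), ∀ k : ℕ, 0 ≤ r - Real.exp (-q * y) * r ^ (k + 1) := by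
    intro y hy k
    have hy0 : 0 < y := hy
    have he : Real.exp (-q * y) ≤ 1 := Real.exp_le_one_iff.mpr (by nlinarith)
    have hp : r ^ (k + 1) ≤ r := pow_le_of_le_one hr0.le hr1.le (Nat.succ_ne_zero k)
    nlinarith [pow_pos hr0 (k + 1), Real.exp_pos (-q * y)]
  have hwt : ∀ y ∈ Ioi (0 : ℝ), ∀ k : ℕ,
      0 ≤ y * Real.exp (-lam * y) * (lam * y) ^ k / (Nat.factorial (k + 1) : ℝ) := by
    intro y hy k
    have hy0 : 0 < y := hy
    positivity
  have hmem : ∀ᵐ y ∂ν.restrict (Ioi 0), y ∈ Ioi (0 : ℝ) := self_mem_ae_restrict (μ := ν) (measurableSet_Ioi (a := (0 : ℝ)))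
  -- the compensators `a * y` cancel in this combination of `psi` integrands
  have hG := (((h2.sub h1).sub (h3.const_mul r)).const_mul lam⁻¹)
  obtain ⟨hint, hsum⟩ := hasSum_integral_of_nonneg
    (g := fun (k : ℕ) y => (r - Real.exp (-q * y) * r ^ (k + 1)) *
      (y * Real.exp (-lam * y) * (lam * y) ^ k / (Nat.factorial (k + 1) : ℝ)))
    (fun k => (by fun_prop : Measurable _).aestronglyMeasurable)
    (hmem.mono fun y hy k => mul_nonneg (hpos y hy k) (hwt y hy k))
    (by
      refine Filter.Eventually.of_forall fun y => ?_
      convert hasSum_jump_integrand hlam.ne' q r y using 1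
      simp only [Pi.sub_apply]
      split_ifs <;> field_simp <;> ring) hG
  have hneg : ∀ k : ℕ, (fun y => (Real.exp (-q * y) * r ^ (k + 1) - r) *
      (y * Real.exp (-lam * y) * (lam * y) ^ k / (Nat.factorial (k + 1) : ℝ)))
      = fun y => -((r - Real.exp (-q * y) * r ^ (k + 1)) *
      (y * Real.exp (-lam * y) * (lam * y) ^ k / (Nat.factorial (k + 1) : ℝ))) :=
    fun k => funext fun y => by ring
  refine ⟨fun k => ?_, ?_, hA, ?_⟩
  · rw [hneg]
    exact (hint k).neg
  · refine hsum.summable.congr fun k => ?_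
    refine setIntegral_congr_fun measurableSet_Ioi fun y hy => ?_
    rw [abs_sub_comm, abs_of_nonneg (hpos y hy k)]
  · simp only [hneg, integral_neg]
    rw [hsum.neg.tsum_eq, integral_const_mul, integral_sub' (h2.sub h1) (h3.const_mul r),
      integral_sub' h2 h1, integral_const_mul]
    simp only [psi]
    field_simp
    ring
end

section
/- Let (γ; b, σ, d, κ, 𝗄; π, ρ) be admissible parameters. For every (q,r) ∈ (0,∞)×(0,1), there exists a unique differentiable function F : [0,∞) → ℝ², F_t = (u_t, f_t), such that u_0 = q, f_0 = r, for every t ≥ 0 one has 0 < u_t < ∞ and 0 < f_t < 1, and F satisfies the system of ordinary differential equations (d/dt)u_t = −Ψ_c(u_t, f_t) and (d/dt)f_t = Ψ_d(u_t, f_t) for all t ≥ 0. -/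
open MeasureTheory Set

/-- Admissibility of the parameters `(γ; b, σ, d, κ, 𝗄; π, ρ)`. -/
def Admissible (γ b σ d κ kk : ℝ) (π ρm : Measure (ℝ × ℕ)) : Prop :=
  0 ≤ b ∧ 0 ≤ σ ∧ 0 ≤ d ∧ 0 ≤ κ ∧ 0 ≤ kk ∧
  IntegrableOn (fun p : ℝ × ℕ => min 1 (p.1 ^ 2)) (Ici (0 : ℝ) ×ˢ ({0} : Set ℕ)) π ∧
  π (Ici (0 : ℝ) ×ˢ {k : ℕ | 1 ≤ k}) < ⊤ ∧
  IntegrableOn (fun p : ℝ × ℕ => min 1 p.1) (Ici (0 : ℝ) ×ˢ ({0} : Set ℕ)) ρm ∧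
  ρm (Ici (0 : ℝ) ×ˢ {k : ℕ | 1 ≤ k}) < ⊤

/-- `Ψ_c(q,r)`. -/
noncomputable def PsiC (γ σ κ : ℝ) (π : Measure (ℝ × ℕ)) (q r : ℝ) : ℝ :=
  (∫ p in Ici (0 : ℝ) ×ˢ (univ : Set ℕ),
      (Real.exp (-q * p.1) * r ^ p.2 - 1 + (if 0 < p.1 ∧ p.1 < 1 then q * p.1 else 0)) ∂π)
    - γ * q + σ ^ 2 / 2 * q ^ 2 - κ

/-- `Ψ_d(q,r)`. -/
noncomputable def PsiD (b d kk : ℝ) (ρm : Measure (ℝ × ℕ)) (q r : ℝ) : ℝ :=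
  (∫ p in Ici (0 : ℝ) ×ˢ (univ : Set ℕ),
      (Real.exp (-q * p.1) * r ^ (p.2 + 1) - r) ∂ρm)
    - b * q * r + d * (1 - r) - kk * r

/-- Structural conditions on an autonomous vector field on `(0,∞) × (0,1)` that make the strip
invariant and rule out explosion. -/
structure IsInwardField (v : ℝ × ℝ → ℝ × ℝ) : Prop where
  lipschitz : ∀ ε M δ δ' : ℝ, 0 < ε → 0 < δ → δ' < 1 →
    ∃ K : NNReal, LipschitzOnWith K v (Icc ε M ×ˢ Icc δ δ')
  fst_le : ∃ A : ℝ, 0 ≤ A ∧ ∀ u f, 0 < u → 0 < f → f < 1 → (v (u, f)).1 ≤ A * (1 + u)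
  le_fst : ∀ M : ℝ, ∃ K : ℝ, ∀ u f, 0 < u → u ≤ M → 0 < f → f < 1 → -(K * u) ≤ (v (u, f)).1
  le_snd : ∀ M : ℝ, ∃ K : ℝ, ∀ u f, 0 < u → u ≤ M → 0 < f → f < 1 → -(K * f) ≤ (v (u, f)).2
  snd_le : ∃ D : ℝ, ∀ u f, 0 < u → 0 < f → f < 1 → (v (u, f)).2 ≤ D * (1 - f)

/-- A field that is Lipschitz on a compact set, composed with a `1`-Lipschitz retraction onto that
set, has solutions on every interval `[0, T]`. -/
theorem LipschitzOnWith.exists_solution_comp_Icc {E : Type*} [NormedAddCommGroup E]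
    [NormedSpace ℝ E] [CompleteSpace E] {v c : E → E} {K : NNReal} {s : Set E} (hs : IsCompact s)
    (hv : LipschitzOnWith K v s) (hc : LipschitzWith 1 c) (hcs : ∀ x, c x ∈ s) (x₀ : E)
    {T : ℝ} (hT : 0 ≤ T) :
    ∃ F : ℝ → E, F 0 = x₀ ∧
      ∀ t ∈ Icc 0 T, HasDerivWithinAt F (v (c (F t))) (Icc 0 T) t := by
  obtain ⟨L, hL⟩ := hs.exists_bound_of_continuousOn hv.continuousOn
  have hL0 : 0 ≤ L := (norm_nonneg _).trans (hL _ (hcs x₀))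
  have hpl : IsPicardLindelof (fun _ : ℝ ↦ v ∘ c) (⟨0, le_rfl, hT⟩ : Icc 0 T) x₀
      (L.toNNReal * T.toNNReal) 0 L.toNNReal (K * 1) := by
    refine IsPicardLindelof.of_time_independent ?_ ?_ ?_
    · intro x _
      simpa [hL0] using hL _ (hcs x)
    · exact hv.comp hc.lipschitzOnWith fun x _ ↦ hcs x
    · simp [hL0, hT]
  obtain ⟨F, hF0, hF⟩ := hpl.exists_eq_forall_mem_Icc_hasDerivWithinAt₀
  exact ⟨F, hF0, hF⟩

theorem le_mul_exp_of_hasDerivWithinAt {w w' : ℝ → ℝ} {T C a : ℝ}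
    (hw : ∀ t ∈ Icc 0 T, HasDerivWithinAt w (w' t) (Icc 0 T) t) (h0 : w 0 ≤ a)
    (bound : ∀ t ∈ Icc 0 T, w t = a * Real.exp (C * t) → w' t < C * w t) :
    ∀ t ∈ Icc 0 T, w t ≤ a * Real.exp (C * t) := by
  refine image_le_of_deriv_right_lt_deriv_boundary (f' := w')
    (B' := fun t ↦ a * (Real.exp (C * t) * (C * 1))) (fun t ht ↦ (hw t ht).continuousWithinAt)
    (fun t ht ↦ ?_) (by simpa using h0)
    (fun t ↦ (((hasDerivAt_id t).const_mul C).exp.const_mul a)) (fun t ht h ↦ ?_)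
  · exact (hw t ⟨ht.1, ht.2.le⟩).mono_of_mem_nhdsWithin
      (Filter.mem_of_superset (Icc_mem_nhdsGE ht.2) (Icc_subset_Icc_left ht.1))
  · have := bound t ⟨ht.1, ht.2.le⟩ h
    rw [h] at this
    linarith

theorem HasDerivWithinAt.prod_fst {F : ℝ → ℝ × ℝ} {F' : ℝ × ℝ} {s : Set ℝ} {t : ℝ}
    (h : HasDerivWithinAt F F' s t) : HasDerivWithinAt (fun x ↦ (F x).1) F'.1 s t := by
  simpa using h.hasFDerivWithinAt.fst.hasDerivWithinAt

theorem HasDerivWithinAt.prod_snd {F : ℝ → ℝ × ℝ} {F' : ℝ × ℝ} {s : Set ℝ} {t : ℝ}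
    (h : HasDerivWithinAt F F' s t) : HasDerivWithinAt (fun x ↦ (F x).2) F'.2 s t := by
  simpa using h.hasFDerivWithinAt.snd.hasDerivWithinAt

theorem IsInwardField.exists_solution_Icc {v : ℝ × ℝ → ℝ × ℝ} (hv : IsInwardField v) {q r : ℝ}
    (hq : 0 < q) (hr0 : 0 < r) (hr1 : r < 1) {T : ℝ} (hT : 0 ≤ T) :
    ∃ F : ℝ → ℝ × ℝ, F 0 = (q, r) ∧
      (∀ t ∈ Icc 0 T, 0 < (F t).1 ∧ 0 < (F t).2 ∧ (F t).2 < 1) ∧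
      ∀ t ∈ Icc 0 T, HasDerivWithinAt F (v (F t)) (Icc 0 T) t := by
  obtain ⟨A, hA, hA'⟩ := hv.fst_le
  set M := (q + 1) * Real.exp ((2 * A + 1) * T) with hM
  obtain ⟨K, hK⟩ : ∃ K : ℝ, 0 ≤ K ∧
      ∀ u f, 0 < u → u ≤ M → 0 < f → f < 1 → -(K * u) ≤ (v (u, f)).1 := by
    obtain ⟨K, hK⟩ := hv.le_fst M
    refine ⟨|K|, abs_nonneg K, fun u f hu huM hf hf1 ↦ le_trans ?_ (hK u f hu huM hf hf1)⟩
    nlinarith [le_abs_self K]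
  obtain ⟨N, hN⟩ : ∃ N : ℝ, 0 ≤ N ∧
      ∀ u f, 0 < u → u ≤ M → 0 < f → f < 1 → -(N * f) ≤ (v (u, f)).2 := by
    obtain ⟨K, hK⟩ := hv.le_snd M
    refine ⟨|K|, abs_nonneg K, fun u f hu huM hf hf1 ↦ le_trans ?_ (hK u f hu huM hf hf1)⟩
    nlinarith [le_abs_self K]
  obtain ⟨D, hD⟩ : ∃ D : ℝ, 0 ≤ D ∧
      ∀ u f, 0 < u → 0 < f → f < 1 → (v (u, f)).2 ≤ D * (1 - f) := by
    obtain ⟨K, hK⟩ := hv.snd_le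
    refine ⟨|K|, abs_nonneg K, fun u f hu hf hf1 ↦ le_trans (hK u f hu hf hf1) ?_⟩
    nlinarith [le_abs_self K]
  set ε := q * Real.exp (-(K + 1) * T) with hε
  set δ := r * Real.exp (-(N + 1) * T) with hδ
  set η := (1 - r) * Real.exp (-(D + 1) * T) with hη
  have hε0 : 0 < ε := by positivity
  have hδ0 : 0 < δ := by positivity
  have hη0 : 0 < η := mul_pos (by linarith) (Real.exp_pos _)
  have exp_le {c : ℝ} (hc : 0 ≤ c) : Real.exp (-(c + 1) * T) ≤ 1 :=
    Real.exp_le_one_iff.2 (by nlinarith)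
  have hεq : ε ≤ q := mul_le_of_le_one_right hq.le (exp_le hK.1)
  have hδr : δ ≤ r := mul_le_of_le_one_right hr0.le (exp_le hN.1)
  have hηr : η ≤ 1 - r := mul_le_of_le_one_right (by linarith) (exp_le hD.1)
  have hMq : q ≤ M := by
    have : 1 ≤ Real.exp ((2 * A + 1) * T) := Real.one_le_exp (by positivity)
    nlinarith
  have hεM : ε ≤ M := hεq.trans hMq
  have hδη : δ ≤ 1 - η := by linarith
  obtain ⟨L, hL⟩ := hv.lipschitz ε M δ (1 - η) hε0 hδ0 (by linarith)
  set c : ℝ × ℝ → ℝ × ℝ := fun x ↦ (projIcc ε M hεM x.1, projIcc δ (1 - η) hδη x.2) with hc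
  have hcL : LipschitzWith 1 c := by
    have h1 := (LipschitzWith.subtype_val _).comp
      ((LipschitzWith.projIcc hεM).comp (LipschitzWith.prod_fst (β := ℝ)))
    have h2 := (LipschitzWith.subtype_val _).comp
      ((LipschitzWith.projIcc hδη).comp (LipschitzWith.prod_snd (α := ℝ)))
    simpa using h1.prodMk h2
  have hcs (x : ℝ × ℝ) : c x ∈ Icc ε M ×ˢ Icc δ (1 - η) :=
    ⟨(projIcc ε M hεM x.1).2, (projIcc δ (1 - η) hδη x.2).2⟩
  obtain ⟨F, hF0, hF⟩ := hL.exists_solution_comp_Icc (isCompact_Icc.prod isCompact_Icc)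
    hcL hcs (q, r) hT
  have hc1 {x : ℝ × ℝ} (hx : x.1 ∈ Icc ε M) : (c x).1 = x.1 := by
    simp [hc, projIcc_of_mem hεM hx]
  have hc2 {x : ℝ × ℝ} (hx : x.2 ∈ Icc δ (1 - η)) : (c x).2 = x.2 := by
    simp [hc, projIcc_of_mem hδη hx]
  have hcpos (x : ℝ × ℝ) : 0 < (c x).1 ∧ (c x).1 ≤ M ∧ 0 < (c x).2 ∧ (c x).2 < 1 :=
    ⟨hε0.trans_le (hcs x).1.1, (hcs x).1.2, hδ0.trans_le (hcs x).2.1, by linarith [(hcs x).2.2]⟩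
  have exp_anti {c t : ℝ} (hc : 0 ≤ c) (ht : t ∈ Icc 0 T) :
      Real.exp (-(c + 1) * T) ≤ Real.exp (-(c + 1) * t) ∧ Real.exp (-(c + 1) * t) ≤ 1 :=
    ⟨Real.exp_le_exp.2 (by nlinarith [ht.2]), Real.exp_le_one_iff.2 (by nlinarith [ht.1])⟩
  have u_le : ∀ t ∈ Icc 0 T, (F t).1 ≤ M := by
    have hB {t : ℝ} (ht : t ∈ Icc 0 T) : (q + 1) * Real.exp ((2 * A + 1) * t) ≤ M :=
      mul_le_mul_of_nonneg_left (Real.exp_le_exp.2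
        (mul_le_mul_of_nonneg_left ht.2 (by positivity))) (by positivity)
    intro t ht
    refine (le_mul_exp_of_hasDerivWithinAt (a := q + 1) (C := 2 * A + 1)
      (fun t ht ↦ (hF t ht).prod_fst) (by simp [hF0]) (fun t ht h ↦ ?_) t ht).trans (hB ht)
    have h1 : q + 1 ≤ (F t).1 := h ▸ le_mul_of_one_le_right (by positivity)
      (Real.one_le_exp (mul_nonneg (by positivity) ht.1))
    obtain ⟨p1, p2, p3, p4⟩ := hcpos (F t)
    have := hA' _ _ p1 p3 p4
    rw [Prod.mk.eta, hc1 ⟨by linarith, h ▸ hB ht⟩] at this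
    nlinarith
  have le_u : ∀ t ∈ Icc 0 T, ε ≤ (F t).1 := by
    intro t ht
    have key := le_mul_exp_of_hasDerivWithinAt (a := -q) (C := -(K + 1))
      (fun t ht ↦ (hF t ht).prod_fst.neg) (by simp [hF0]) (fun t ht h ↦ ?_) t ht
    · have := mul_le_mul_of_nonneg_left (exp_anti hK.1 ht).1 hq.le
      simp only [Pi.neg_apply] at key
      linarith
    · simp only [Pi.neg_apply] at h ⊢
      have e1 := mul_le_mul_of_nonneg_left (exp_anti hK.1 ht).1 hq.le
      obtain ⟨p1, p2, p3, p4⟩ := hcpos (F t)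
      have := hK.2 _ _ p1 p2 p3 p4
      rw [Prod.mk.eta, hc1 ⟨by linarith, u_le t ht⟩] at this
      nlinarith
  have le_f : ∀ t ∈ Icc 0 T, δ ≤ (F t).2 := by
    intro t ht
    have key := le_mul_exp_of_hasDerivWithinAt (a := -r) (C := -(N + 1))
      (fun t ht ↦ (hF t ht).prod_snd.neg) (by simp [hF0]) (fun t ht h ↦ ?_) t ht
    · have := mul_le_mul_of_nonneg_left (exp_anti hN.1 ht).1 hr0.le
      simp only [Pi.neg_apply] at key
      linarith
    · simp only [Pi.neg_apply] at h ⊢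
      obtain ⟨e1, e2⟩ := exp_anti hN.1 ht
      have e1 := mul_le_mul_of_nonneg_left e1 hr0.le
      have e2 := mul_le_mul_of_nonneg_left e2 hr0.le
      obtain ⟨p1, p2, p3, p4⟩ := hcpos (F t)
      have := hN.2 _ _ p1 p2 p3 p4
      rw [Prod.mk.eta, hc2 ⟨by linarith, by linarith⟩] at this
      nlinarith
  have f_le : ∀ t ∈ Icc 0 T, (F t).2 ≤ 1 - η := by
    intro t ht
    have key := le_mul_exp_of_hasDerivWithinAt (a := r - 1) (C := -(D + 1))
      (fun t ht ↦ (hF t ht).prod_snd.sub_const 1) (by simp [hF0]) (fun t ht h ↦ ?_) t ht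
    · have := mul_le_mul_of_nonneg_left (exp_anti hD.1 ht).1 (sub_pos.2 hr1).le
      linarith
    · obtain ⟨e1, e2⟩ := exp_anti hD.1 ht
      have e1 := mul_le_mul_of_nonneg_left e1 (sub_pos.2 hr1).le
      obtain ⟨p1, p2, p3, p4⟩ := hcpos (F t)
      have := hD.2 _ _ p1 p3 p4
      rw [Prod.mk.eta, hc2 ⟨le_f t ht, by linarith⟩] at this
      nlinarith
  refine ⟨F, hF0, fun t ht ↦ ⟨hε0.trans_le (le_u t ht), hδ0.trans_le (le_f t ht),
    by linarith [f_le t ht]⟩, fun t ht ↦ ?_⟩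
  have hcF : c (F t) = F t :=
    Prod.ext (hc1 ⟨le_u t ht, u_le t ht⟩) (hc2 ⟨le_f t ht, f_le t ht⟩)
  simpa only [hcF] using hF t ht

theorem IsInwardField.eqOn_Icc {v : ℝ × ℝ → ℝ × ℝ} (hv : IsInwardField v) {F G : ℝ → ℝ × ℝ}
    {T : ℝ} (h0 : F 0 = G 0)
    (hFs : ∀ t ∈ Icc 0 T, 0 < (F t).1 ∧ 0 < (F t).2 ∧ (F t).2 < 1)
    (hF : ∀ t ∈ Icc 0 T, HasDerivWithinAt F (v (F t)) (Icc 0 T) t)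
    (hGs : ∀ t ∈ Icc 0 T, 0 < (G t).1 ∧ 0 < (G t).2 ∧ (G t).2 < 1)
    (hG : ∀ t ∈ Icc 0 T, HasDerivWithinAt G (v (G t)) (Icc 0 T) t) :
    EqOn F G (Icc 0 T) := by
  have box {H : ℝ → ℝ × ℝ} (hH : ContinuousOn H (Icc 0 T))
      (hHs : ∀ t ∈ Icc 0 T, 0 < (H t).1 ∧ 0 < (H t).2 ∧ (H t).2 < 1) :
      ∃ ε M δ δ' : ℝ, 0 < ε ∧ 0 < δ ∧ δ' < 1 ∧
        ∀ t ∈ Icc 0 T, H t ∈ Icc ε M ×ˢ Icc δ δ' := by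
    have hH1 : ContinuousOn (fun t ↦ (H t).1) (Icc 0 T) := continuous_fst.comp_continuousOn hH
    have hH2 : ContinuousOn (fun t ↦ (H t).2) (Icc 0 T) := continuous_snd.comp_continuousOn hH
    obtain ⟨ε, hε, hε'⟩ := isCompact_Icc.exists_forall_le' hH1 fun t ht ↦ (hHs t ht).1
    obtain ⟨M, hM⟩ := isCompact_Icc.exists_bound_of_continuousOn hH1
    obtain ⟨δ, hδ, hδ'⟩ := isCompact_Icc.exists_forall_le' hH2 fun t ht ↦ (hHs t ht).2.1
    obtain ⟨η, hη, hη'⟩ := isCompact_Icc.exists_forall_le' (continuousOn_const.sub hH2)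
      fun t ht ↦ sub_pos.2 (hHs t ht).2.2
    exact ⟨ε, M, δ, 1 - η, hε, hδ, by linarith, fun t ht ↦
      ⟨⟨hε' t ht, (le_abs_self _).trans (hM t ht)⟩, hδ' t ht, le_sub_comm.1 (hη' t ht)⟩⟩
  have hFc : ContinuousOn F (Icc 0 T) := fun t ht ↦ (hF t ht).continuousWithinAt
  have hGc : ContinuousOn G (Icc 0 T) := fun t ht ↦ (hG t ht).continuousWithinAt
  obtain ⟨ε₁, M₁, δ₁, δ₁', hε₁, hδ₁, hδ₁', hb₁⟩ := box hFc hFs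
  obtain ⟨ε₂, M₂, δ₂, δ₂', hε₂, hδ₂, hδ₂', hb₂⟩ := box hGc hGs
  obtain ⟨K, hK⟩ := hv.lipschitz (min ε₁ ε₂) (max M₁ M₂) (min δ₁ δ₂) (max δ₁' δ₂')
    (lt_min hε₁ hε₂) (lt_min hδ₁ hδ₂) (max_lt hδ₁' hδ₂')
  have right {H : ℝ → ℝ × ℝ} (hH : ∀ t ∈ Icc 0 T, HasDerivWithinAt H (v (H t)) (Icc 0 T) t) :
      ∀ t ∈ Ico 0 T, HasDerivWithinAt H (v (H t)) (Ici t) t := fun t ht ↦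
    (hH t ⟨ht.1, ht.2.le⟩).mono_of_mem_nhdsWithin
      (Filter.mem_of_superset (Icc_mem_nhdsGE ht.2) (Icc_subset_Icc_left ht.1))
  refine ODE_solution_unique_of_mem_Icc_right (v := fun _ ↦ v) (fun _ _ ↦ hK) hFc (right hF)
    (fun t ht ↦ ?_) hGc (right hG) (fun t ht ↦ ?_) h0
  · exact prod_mono (Icc_subset_Icc (min_le_left _ _) (le_max_left _ _))
      (Icc_subset_Icc (min_le_left _ _) (le_max_left _ _)) (hb₁ t ⟨ht.1, ht.2.le⟩)
  · exact prod_mono (Icc_subset_Icc (min_le_right _ _) (le_max_right _ _))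
      (Icc_subset_Icc (min_le_right _ _) (le_max_right _ _)) (hb₂ t ⟨ht.1, ht.2.le⟩)

theorem IsInwardField.exists_unique_solution {v : ℝ × ℝ → ℝ × ℝ} (hv : IsInwardField v)
    {q r : ℝ} (hq : 0 < q) (hr0 : 0 < r) (hr1 : r < 1) :
    ∃ F : ℝ → ℝ × ℝ,
      (F 0 = (q, r) ∧
        (∀ t ∈ Ici (0 : ℝ), 0 < (F t).1 ∧ 0 < (F t).2 ∧ (F t).2 < 1) ∧
        (∀ t ∈ Ici (0 : ℝ), HasDerivWithinAt F (v (F t)) (Ici 0) t)) ∧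
      (∀ G : ℝ → ℝ × ℝ,
        (G 0 = (q, r) ∧
          (∀ t ∈ Ici (0 : ℝ), 0 < (G t).1 ∧ 0 < (G t).2 ∧ (G t).2 < 1) ∧
          (∀ t ∈ Ici (0 : ℝ), HasDerivWithinAt G (v (G t)) (Ici 0) t)) →
        ∀ t ∈ Ici (0 : ℝ), G t = F t) := by
  choose! S hS0 hSs hS using
    fun (T : ℝ) (hT : 0 ≤ T) ↦ hv.exists_solution_Icc hq hr0 hr1 hT
  have hmono {T T' : ℝ} (hT : 0 ≤ T) (hTT' : T ≤ T') : EqOn (S T) (S T') (Icc 0 T) := by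
    have hsub : Icc 0 T ⊆ Icc 0 T' := Icc_subset_Icc_right hTT'
    have hT' := hT.trans hTT'
    exact hv.eqOn_Icc ((hS0 T hT).trans (hS0 T' hT').symm) (hSs T hT) (hS T hT)
      (fun t ht ↦ hSs T' hT' t (hsub ht)) fun t ht ↦ (hS T' hT' t (hsub ht)).mono hsub
  have hagree {s t : ℝ} (hs : 0 ≤ s) (ht : 0 ≤ t) (hst : s ≤ t + 1) :
      S (s + 1) s = S (t + 1) s := by
    rcases le_total s t with h | h
    · exact hmono (by linarith) (by linarith) ⟨hs, by linarith⟩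
    · exact (hmono (T := t + 1) (by linarith) (by linarith) ⟨hs, hst⟩).symm
  refine ⟨fun t ↦ S (t + 1) t, ⟨hS0 _ (by norm_num), fun t (ht : 0 ≤ t) ↦
    hSs _ (by linarith) t ⟨ht, by linarith⟩, fun t (ht : 0 ≤ t) ↦ ?_⟩, ?_⟩
  · have hnhds : Icc 0 (t + 1) ∈ nhdsWithin t (Ici 0) := by
      filter_upwards [self_mem_nhdsWithin,
        mem_nhdsWithin_of_mem_nhds (Iic_mem_nhds (lt_add_one t))] with s h1 h2 using ⟨h1, h2⟩
    refine ((hS (t + 1) (by linarith) t ⟨ht, by linarith⟩).mono_of_mem_nhdsWithin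
      hnhds).congr_of_eventuallyEq ?_ rfl
    filter_upwards [hnhds] with s hs using hagree hs.1 ht hs.2
  · rintro G ⟨hG0, hGs, hG⟩ t (ht : 0 ≤ t)
    exact hv.eqOn_Icc (T := t + 1) (hG0.trans (hS0 _ (by linarith)).symm)
      (fun s hs ↦ hGs s hs.1) (fun s hs ↦ (hG s hs.1).mono Icc_subset_Ici_self)
      (hSs _ (by linarith)) (hS _ (by linarith)) ⟨ht, by linarith⟩

theorem abs_pow_sub_pow_le_div {x y δ : ℝ} (hx : 0 ≤ x) (hxδ : x ≤ δ) (hy : 0 ≤ y) (hyδ : y ≤ δ)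
    (hδ : δ < 1) (n : ℕ) : |x ^ n - y ^ n| ≤ |x - y| / (1 - δ) := by
  have h1 : 0 < 1 - δ := by linarith
  induction n with
  | zero => simp; positivity
  | succ n ih =>
    have hyn : |y ^ n| ≤ 1 := by
      rw [abs_of_nonneg (by positivity)]
      exact pow_le_one₀ hy (by linarith)
    calc |x ^ (n + 1) - y ^ (n + 1)| = |x * (x ^ n - y ^ n) + y ^ n * (x - y)| := by ring_nf
      _ ≤ |x| * |x ^ n - y ^ n| + |y ^ n| * |x - y| := by
        rw [← abs_mul, ← abs_mul]
        exact abs_add_le _ _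
      _ ≤ δ * (|x - y| / (1 - δ)) + 1 * |x - y| := by
        rw [abs_of_nonneg hx]
        gcongr
        exact hx.trans hxδ
      _ = |x - y| / (1 - δ) := by field_simp; ring

theorem abs_exp_neg_mul_sub_le {u v y : ℝ} (hu : 0 ≤ u) (hv : 0 ≤ v) (hy : 0 ≤ y) :
    |Real.exp (-u * y) - Real.exp (-v * y)| ≤ |u - v| * y := by
  wlog huv : u ≤ v generalizing u v
  · rw [abs_sub_comm, abs_sub_comm u]
    exact this hv hu (le_of_not_ge huv)
  have h1 : Real.exp (-v * y) = Real.exp (-u * y) * Real.exp (-((v - u) * y)) := by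
    rw [← Real.exp_add]; ring_nf
  have h2 := Real.one_sub_le_exp_neg ((v - u) * y)
  have h3 : Real.exp (-((v - u) * y)) ≤ 1 := Real.exp_le_one_iff.2 (by nlinarith)
  have h4 : Real.exp (-u * y) ≤ 1 := Real.exp_le_one_iff.2 (by nlinarith)
  have h5 := Real.exp_pos (-u * y)
  rw [h1, abs_sub_comm u, abs_of_nonneg (by linarith : 0 ≤ v - u), abs_of_nonneg (by nlinarith)]
  nlinarith

theorem abs_exp_neg_mul_sub_le_div {ε u v y : ℝ} (hε : 0 < ε) (hu : ε ≤ u) (hv : ε ≤ v)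
    (hy : 0 ≤ y) : |Real.exp (-u * y) - Real.exp (-v * y)| ≤ |u - v| / ε := by
  have h := abs_exp_neg_mul_sub_le (sub_nonneg.2 hu) (sub_nonneg.2 hv) hy
  have e (w : ℝ) : Real.exp (-w * y) = Real.exp (-(ε * y)) * Real.exp (-(w - ε) * y) := by
    rw [← Real.exp_add]; ring_nf
  have hεy : Real.exp (-(ε * y)) * (ε * y) ≤ 1 := by
    rw [Real.exp_neg, inv_mul_le_iff₀ (Real.exp_pos _)]
    linarith [Real.add_one_le_exp (ε * y)]
  rw [e u, e v, ← mul_sub, abs_mul, abs_of_pos (Real.exp_pos _), le_div_iff₀ hε]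
  calc _ ≤ Real.exp (-(ε * y)) * (|u - ε - (v - ε)| * y) * ε := by gcongr
    _ = |u - v| * (Real.exp (-(ε * y)) * (ε * y)) := by rw [sub_sub_sub_cancel_right]; ring
    _ ≤ |u - v| := mul_le_of_le_one_right (abs_nonneg _) hεy

theorem abs_exp_neg_mul_sub_add_le {M u v y : ℝ} (hu : 0 ≤ u) (huM : u ≤ M) (hv : 0 ≤ v)
    (hvM : v ≤ M) (hy : 0 ≤ y) :
    |Real.exp (-u * y) + u * y - (Real.exp (-v * y) + v * y)| ≤ |u - v| * (M * y ^ 2) := by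
  wlog huv : u ≤ v generalizing u v
  · rw [abs_sub_comm, abs_sub_comm u]
    exact this hv hvM hu huM (le_of_not_ge huv)
  have e (w : ℝ) : -w * y = -(w * y) := by ring
  have h1 : Real.exp (-(u * y)) = Real.exp (-(v * y)) * Real.exp ((v - u) * y) := by
    rw [← Real.exp_add]; ring_nf
  have h1' : Real.exp (-(v * y)) = Real.exp (-(u * y)) * Real.exp (-((v - u) * y)) := by
    rw [← Real.exp_add]; ring_nf
  have h2 := Real.one_sub_le_exp_neg ((v - u) * y)
  have h3 := Real.add_one_le_exp ((v - u) * y)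
  have h4 := Real.one_sub_le_exp_neg (v * y)
  have h5 : Real.exp (-(u * y)) ≤ 1 := Real.exp_le_one_iff.2 (by nlinarith)
  have h6 := Real.exp_pos (-(u * y))
  have h7 := Real.exp_pos (-(v * y))
  have hs : 0 ≤ (v - u) * y := mul_nonneg (by linarith) hy
  have upper : Real.exp (-(u * y)) - Real.exp (-(v * y)) ≤ (v - u) * y := by
    rw [h1']; nlinarith
  have lower : (1 - v * y) * ((v - u) * y) ≤ Real.exp (-(u * y)) - Real.exp (-(v * y)) := by
    rw [h1]; nlinarith
  have hvM' : v * y * ((v - u) * y) ≤ M * y * ((v - u) * y) := by gcongr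
  rw [e, e, abs_sub_comm u, abs_of_nonneg (by linarith : 0 ≤ v - u), abs_le]
  constructor <;> nlinarith

/-- A weight on `[0,∞) × ℕ` dominating the compensated integrands: `g` on the level `k = 0`,
and `1` on the levels `k ≥ 1`. -/
def levelWeight (g : ℝ → ℝ) (p : ℝ × ℕ) : ℝ := if p.2 = 0 then g p.1 else 1

theorem integrableOn_levelWeight {g : ℝ → ℝ} {μ : Measure (ℝ × ℕ)}
    (h0 : IntegrableOn (fun p : ℝ × ℕ ↦ g p.1) (Ici (0 : ℝ) ×ˢ ({0} : Set ℕ)) μ)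
    (h1 : μ (Ici (0 : ℝ) ×ˢ {k : ℕ | 1 ≤ k}) < ⊤) :
    IntegrableOn (levelWeight g) (Ici (0 : ℝ) ×ˢ (univ : Set ℕ)) μ := by
  have hU : Ici (0 : ℝ) ×ˢ (univ : Set ℕ) =
      Ici (0 : ℝ) ×ˢ ({0} : Set ℕ) ∪ Ici (0 : ℝ) ×ˢ {k : ℕ | 1 ≤ k} := by
    rw [← prod_union]
    congr 1
    ext k
    simp
    omega
  rw [hU]
  refine IntegrableOn.union (h0.congr_fun ?_ (measurableSet_Ici.prod (measurableSet_singleton 0)))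
    ((integrableOn_const (C := (1 : ℝ)) h1.ne).congr_fun ?_
      (measurableSet_Ici.prod (measurableSet_le measurable_const measurable_id)))
  · rintro ⟨y, k⟩ ⟨-, hk⟩
    simp_all [levelWeight]
  · rintro ⟨y, k⟩ ⟨-, hk⟩
    have : k ≠ 0 := by simpa [Nat.one_le_iff_ne_zero] using hk
    simp [levelWeight, this]

/-- The integrand of `PsiC`. -/
noncomputable def psiCKernel (u f : ℝ) (p : ℝ × ℕ) : ℝ :=
  Real.exp (-u * p.1) * f ^ p.2 - 1 + (if 0 < p.1 ∧ p.1 < 1 then u * p.1 else 0)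

/-- The integrand of `PsiD`. -/
noncomputable def psiDKernel (u f : ℝ) (p : ℝ × ℕ) : ℝ :=
  Real.exp (-u * p.1) * f ^ (p.2 + 1) - f

theorem measurable_psiCKernel (u f : ℝ) : Measurable (psiCKernel u f) := by
  unfold psiCKernel
  refine Measurable.add (by fun_prop) (Measurable.ite ?_ (by fun_prop) (by fun_prop))
  exact (measurableSet_lt measurable_const measurable_fst).inter
    (measurableSet_lt measurable_fst measurable_const)

theorem measurable_psiDKernel (u f : ℝ) : Measurable (psiDKernel u f) := by
  unfold psiDKernel
  fun_prop

section Pointwise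

variable {u f : ℝ} {p : ℝ × ℕ}

theorem exp_mul_pow_mem (hu : 0 < u) (hf : 0 < f) (hf1 : f < 1) (hp : 0 ≤ p.1) :
    0 < Real.exp (-u * p.1) * f ^ p.2 ∧ Real.exp (-u * p.1) * f ^ p.2 ≤ 1 :=
  ⟨by positivity, mul_le_one₀ (Real.exp_le_one_iff.2 (by nlinarith)) (by positivity)
    (pow_le_one₀ hf.le hf1.le)⟩

theorem neg_psiCKernel_le (hu : 0 < u) (hf : 0 < f) (hf1 : f < 1) (hp : 0 ≤ p.1) :
    -psiCKernel u f p ≤ levelWeight (fun y ↦ min 1 (y ^ 2)) p := by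
  obtain ⟨y, k⟩ := p
  obtain ⟨h0, h1⟩ := exp_mul_pow_mem hu hf hf1 hp
  have hy : 0 ≤ y := hp
  simp only [psiCKernel, levelWeight] at *
  rcases Nat.eq_zero_or_pos k with rfl | hk
  · have h2 := Real.one_sub_le_exp_neg (u * y)
    have h3 : (0 : ℝ) ≤ min 1 (y ^ 2) := by positivity
    rw [← neg_mul] at h2
    simp only [if_true, pow_zero, mul_one] at *
    split_ifs with h
    · linarith
    · rcases hy.eq_or_lt with rfl | hy
      · simp
      · have : 1 ≤ y := by by_contra! h'; exact h ⟨hy, h'⟩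
        rw [min_eq_left (one_le_pow₀ this)]
        linarith
  · rw [if_neg hk.ne']
    split_ifs
    · nlinarith
    · linarith

theorem psiCKernel_le {M : ℝ} (hu : 0 < u) (huM : u ≤ M) (hf : 0 < f) (hf1 : f < 1)
    (hp : 0 ≤ p.1) :
    psiCKernel u f p ≤ (M + 1) * u * levelWeight (fun y ↦ min 1 (y ^ 2)) p := by
  obtain ⟨y, k⟩ := p
  obtain ⟨h0, h1⟩ := exp_mul_pow_mem hu hf hf1 hp
  have hy : 0 ≤ y := hp
  simp only [psiCKernel, levelWeight] at *
  rcases Nat.eq_zero_or_pos k with rfl | hk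
  · have h3 : (0 : ℝ) ≤ min 1 (y ^ 2) := by positivity
    have h4 : 0 ≤ (M + 1) * u * min 1 (y ^ 2) :=
      mul_nonneg (mul_nonneg (by linarith) hu.le) h3
    simp only [if_true, pow_zero, mul_one] at *
    split_ifs with h
    · have h5 := abs_exp_neg_mul_sub_add_le hu.le le_rfl le_rfl hu.le hy
      rw [min_eq_right (pow_le_one₀ hy h.2.le)]
      simp only [neg_zero, zero_mul, Real.exp_zero, sub_zero, abs_of_pos hu] at h5
      have h6 := (abs_le.1 h5).2
      have h7 : u * (u * y ^ 2) ≤ u * (M * y ^ 2) := by gcongr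
      nlinarith [mul_nonneg hu.le (sq_nonneg y)]
    · linarith
  · rw [if_neg hk.ne']
    split_ifs with h
    · nlinarith
    · nlinarith

theorem abs_psiCKernel_sub_le {ε M δ δ' u' f' : ℝ} (hε : 0 < ε) (hδ : 0 < δ) (hδ' : δ' < 1)
    (hu : u ∈ Icc ε M) (hf : f ∈ Icc δ δ') (hu' : u' ∈ Icc ε M) (hf' : f' ∈ Icc δ δ')
    (hp : 0 ≤ p.1) :
    |psiCKernel u f p - psiCKernel u' f' p| ≤
      (M + 1 / ε + 1 + 1 / (1 - δ')) * (|u - u'| + |f - f'|) *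
        levelWeight (fun y ↦ min 1 (y ^ 2)) p := by
  obtain ⟨y, k⟩ := p
  have hy : 0 ≤ y := hp
  have hu0 : 0 ≤ u := hε.le.trans hu.1
  have hu0' : 0 ≤ u' := hε.le.trans hu'.1
  have hM : 0 ≤ M := hu0.trans hu.2
  have hε' : 0 < 1 / ε := by positivity
  have hδ'' : 0 < 1 / (1 - δ') := one_div_pos.2 (by linarith)
  have hexp := abs_exp_neg_mul_sub_le_div hε hu.1 hu'.1 hy
  rw [div_eq_mul_one_div] at hexp
  have hA := abs_nonneg (u - u')
  have hB := abs_nonneg (f - f')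
  simp only [psiCKernel, levelWeight]
  generalize 1 / ε = a at *
  rcases Nat.eq_zero_or_pos k with rfl | hk
  · generalize 1 / (1 - δ') = c at *
    simp only [if_true, pow_zero, mul_one]
    split_ifs with h
    · rw [min_eq_right (pow_le_one₀ hy h.2.le)]
      have h5 := abs_exp_neg_mul_sub_add_le hu0 hu.2 hu0' hu'.2 hy
      calc _ = |Real.exp (-u * y) + u * y - (Real.exp (-u' * y) + u' * y)| := by ring_nf
        _ ≤ |u - u'| * (M * y ^ 2) := h5
        _ = M * |u - u'| * y ^ 2 := by ring
        _ ≤ _ := by gcongr <;> linarith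
    · rcases hy.eq_or_lt with rfl | hy
      · simp
      · have : 1 ≤ y := by by_contra! h'; exact h ⟨hy, h'⟩
        rw [min_eq_left (one_le_pow₀ this)]
        simp only [add_zero, sub_sub_sub_cancel_right]
        nlinarith
  · rw [if_neg hk.ne']
    have hpow := abs_pow_sub_pow_le_div (hδ.le.trans hf.1) hf.2 (hδ.le.trans hf'.1) hf'.2 hδ' k
    rw [div_eq_mul_one_div] at hpow
    have hprod : |Real.exp (-u * y) * f ^ k - Real.exp (-u' * y) * f' ^ k| ≤
        |u - u'| * a + |f - f'| * (1 / (1 - δ')) := by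
      have e1 : |Real.exp (-u * y)| ≤ 1 := by
        rw [abs_of_pos (Real.exp_pos _)]
        exact Real.exp_le_one_iff.2 (by nlinarith)
      have e2 : |f' ^ k| ≤ 1 := by
        have : 0 ≤ f' := hδ.le.trans hf'.1
        rw [abs_of_nonneg (by positivity)]
        exact pow_le_one₀ this (hf'.2.trans hδ'.le)
      calc _ = |(Real.exp (-u * y) - Real.exp (-u' * y)) * f' ^ k
            + Real.exp (-u * y) * (f ^ k - f' ^ k)| := by ring_nf
        _ ≤ |Real.exp (-u * y) - Real.exp (-u' * y)| * |f' ^ k|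
            + |Real.exp (-u * y)| * |f ^ k - f' ^ k| := by
          rw [← abs_mul, ← abs_mul]
          exact abs_add_le _ _
        _ ≤ |Real.exp (-u * y) - Real.exp (-u' * y)| * 1 + 1 * |f ^ k - f' ^ k| := by gcongr
        _ ≤ _ := by linarith
    generalize 1 / (1 - δ') = c at *
    have hlin : |(if 0 < y ∧ y < 1 then u * y else 0) - (if 0 < y ∧ y < 1 then u' * y else 0)| ≤
        |u - u'| := by
      split_ifs with h
      · rw [← sub_mul, abs_mul, abs_of_pos h.1]
        exact mul_le_of_le_one_right hA h.2.le
      · simp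
    calc
      _ = |(Real.exp (-u * y) * f ^ k - Real.exp (-u' * y) * f' ^ k) +
          ((if 0 < y ∧ y < 1 then u * y else 0) - (if 0 < y ∧ y < 1 then u' * y else 0))| := by
          ring_nf
      _ ≤ |u - u'| * a + |f - f'| * c + |u - u'| := (abs_add_le _ _).trans (add_le_add hprod hlin)
      _ ≤ _ := by nlinarith [mul_nonneg hA hM, mul_nonneg hB hM, mul_nonneg hB hε'.le,
          mul_nonneg hA hδ''.le]

theorem psiDKernel_nonpos (hu : 0 < u) (hf : 0 < f) (hf1 : f < 1) (hp : 0 ≤ p.1) :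
    psiDKernel u f p ≤ 0 := by
  have h := exp_mul_pow_mem (p := p) hu hf hf1 hp
  rw [psiDKernel, pow_succ, ← mul_assoc]
  nlinarith

theorem neg_psiDKernel_le {M : ℝ} (hu : 0 < u) (huM : u ≤ M) (hf : 0 < f) (hf1 : f < 1)
    (hp : 0 ≤ p.1) :
    -psiDKernel u f p ≤ (M + 1) * f * levelWeight (fun y ↦ min 1 y) p := by
  obtain ⟨y, k⟩ := p
  obtain ⟨h0, h1⟩ := exp_mul_pow_mem hu hf hf1 hp
  have hy : 0 ≤ y := hp
  have h2 := Real.one_sub_le_exp_neg (u * y)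
  rw [← neg_mul] at h2
  have hM : 0 < M := hu.trans_le huM
  simp only [psiDKernel, levelWeight] at *
  rcases Nat.eq_zero_or_pos k with rfl | hk
  · simp only [if_true, pow_zero, mul_one, zero_add, pow_one] at *
    have h3 : 1 - Real.exp (-u * y) ≤ (M + 1) * min 1 y := by
      rcases le_total 1 y with h | h
      · rw [min_eq_left h]; linarith
      · rw [min_eq_right h]; nlinarith
    nlinarith
  · rw [if_neg hk.ne', pow_succ, ← mul_assoc]
    nlinarith

theorem abs_psiDKernel_sub_le {ε M δ δ' u' f' : ℝ} (hε : 0 < ε) (hδ : 0 < δ) (hδ' : δ' < 1)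
    (hu : u ∈ Icc ε M) (hf : f ∈ Icc δ δ') (hu' : u' ∈ Icc ε M) (hf' : f' ∈ Icc δ δ')
    (hp : 0 ≤ p.1) :
    |psiDKernel u f p - psiDKernel u' f' p| ≤
      (M + 1 / ε + 2 + 1 / (1 - δ')) * (|u - u'| + |f - f'|) *
        levelWeight (fun y ↦ min 1 y) p := by
  obtain ⟨y, k⟩ := p
  have hy : 0 ≤ y := hp
  have hu0 : 0 ≤ u := hε.le.trans hu.1
  have hu0' : 0 ≤ u' := hε.le.trans hu'.1
  have hf0' : 0 ≤ f' := hδ.le.trans hf'.1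
  have hM : 0 ≤ M := hu0.trans hu.2
  have hε' : 0 < 1 / ε := by positivity
  have hδ'' : 0 < 1 / (1 - δ') := one_div_pos.2 (by linarith)
  have hexp := abs_exp_neg_mul_sub_le_div hε hu.1 hu'.1 hy
  have hexp' := abs_exp_neg_mul_sub_le hu0 hu0' hy
  rw [div_eq_mul_one_div] at hexp
  have hA := abs_nonneg (u - u')
  have hB := abs_nonneg (f - f')
  have e1 : Real.exp (-u * y) ≤ 1 := Real.exp_le_one_iff.2 (by nlinarith)
  simp only [psiDKernel, levelWeight]
  generalize 1 / ε = a at *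
  rcases Nat.eq_zero_or_pos k with rfl | hk
  · generalize 1 / (1 - δ') = c at *
    simp only [if_true, zero_add, pow_one]
    have e2 : |1 - Real.exp (-u * y)| ≤ (M + 1) * min 1 y := by
      have h2 := Real.one_sub_le_exp_neg (u * y)
      rw [← neg_mul] at h2
      rw [abs_of_nonneg (by linarith)]
      have := Real.exp_pos (-u * y)
      rcases le_total 1 y with h | h
      · rw [min_eq_left h]; linarith
      · rw [min_eq_right h]; nlinarith [hu.2]
    have e3 : |Real.exp (-u * y) - Real.exp (-u' * y)| ≤ (a + 1) * |u - u'| * min 1 y := by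
      rcases le_total 1 y with h | h
      · rw [min_eq_left h]; linarith
      · rw [min_eq_right h]; nlinarith [mul_nonneg (mul_nonneg hA hε'.le) hy]
    have e4 : 0 ≤ min 1 y := by positivity
    have e5 : |f'| ≤ 1 := by rw [abs_of_nonneg hf0']; linarith [hf'.2]
    calc _ = |(Real.exp (-u * y) - Real.exp (-u' * y)) * f'
          - (1 - Real.exp (-u * y)) * (f - f')| := by ring_nf
      _ ≤ |Real.exp (-u * y) - Real.exp (-u' * y)| * |f'|
          + |1 - Real.exp (-u * y)| * |f - f'| := by
        rw [← abs_mul, ← abs_mul]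
        exact abs_sub _ _
      _ ≤ (a + 1) * |u - u'| * min 1 y * 1 + (M + 1) * min 1 y * |f - f'| := by gcongr
      _ = ((a + 1) * |u - u'| + (M + 1) * |f - f'|) * min 1 y := by ring
      _ ≤ _ := by
        refine mul_le_mul_of_nonneg_right ?_ e4
        nlinarith [mul_nonneg hA hM, mul_nonneg hB hε'.le, mul_nonneg hA hδ''.le,
          mul_nonneg hB hδ''.le]
  · rw [if_neg hk.ne']
    have hpow := abs_pow_sub_pow_le_div (hδ.le.trans hf.1) hf.2 hf0' hf'.2 hδ' (k + 1)
    rw [div_eq_mul_one_div] at hpow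
    generalize 1 / (1 - δ') = c at *
    have e1' : |Real.exp (-u * y)| ≤ 1 := by rwa [abs_of_pos (Real.exp_pos _)]
    have e2 : |f' ^ (k + 1)| ≤ 1 := by
      rw [abs_of_nonneg (by positivity)]
      exact pow_le_one₀ hf0' (hf'.2.trans hδ'.le)
    calc _ = |(Real.exp (-u * y) - Real.exp (-u' * y)) * f' ^ (k + 1)
          + Real.exp (-u * y) * (f ^ (k + 1) - f' ^ (k + 1)) - (f - f')| := by ring_nf
      _ ≤ |Real.exp (-u * y) - Real.exp (-u' * y)| * |f' ^ (k + 1)|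
          + |Real.exp (-u * y)| * |f ^ (k + 1) - f' ^ (k + 1)| + |f - f'| := by
        rw [← abs_mul, ← abs_mul]
        exact (abs_sub _ _).trans (add_le_add_left (abs_add_le _ _) _)
      _ ≤ |Real.exp (-u * y) - Real.exp (-u' * y)| * 1 + 1 * |f ^ (k + 1) - f' ^ (k + 1)|
          + |f - f'| := by gcongr
      _ ≤ _ := by nlinarith [mul_nonneg hA hM, mul_nonneg hB hM, mul_nonneg hB hε'.le,
          mul_nonneg hA hδ''.le]

end Pointwise

section Integrated

variable {μ : Measure (ℝ × ℕ)} {u f : ℝ}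

theorem integrableOn_psiCKernel
    (hw : IntegrableOn (levelWeight fun y ↦ min 1 (y ^ 2)) (Ici (0 : ℝ) ×ˢ (univ : Set ℕ)) μ)
    (hu : 0 < u) (hf : 0 < f) (hf1 : f < 1) :
    IntegrableOn (psiCKernel u f) (Ici (0 : ℝ) ×ˢ (univ : Set ℕ)) μ := by
  refine (hw.const_mul ((u + 1) * u + 1)).mono' (measurable_psiCKernel u f).aestronglyMeasurable
    (ae_restrict_of_forall_mem (measurableSet_Ici.prod MeasurableSet.univ) fun p hp ↦ ?_)
  have h1 := neg_psiCKernel_le hu hf hf1 hp.1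
  have h2 := psiCKernel_le hu le_rfl hf hf1 hp.1
  have h3 : 0 ≤ levelWeight (fun y ↦ min 1 (y ^ 2)) p := by
    unfold levelWeight; split_ifs <;> positivity
  have h4 : 0 ≤ (u + 1) * u * levelWeight (fun y ↦ min 1 (y ^ 2)) p := by positivity
  rw [Real.norm_eq_abs, abs_le]
  constructor <;> linarith

theorem integrableOn_psiDKernel
    (hw : IntegrableOn (levelWeight fun y ↦ min 1 y) (Ici (0 : ℝ) ×ˢ (univ : Set ℕ)) μ)
    (hu : 0 < u) (hf : 0 < f) (hf1 : f < 1) :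
    IntegrableOn (psiDKernel u f) (Ici (0 : ℝ) ×ˢ (univ : Set ℕ)) μ := by
  refine (hw.const_mul ((u + 1) * f)).mono' (measurable_psiDKernel u f).aestronglyMeasurable
    (ae_restrict_of_forall_mem (measurableSet_Ici.prod MeasurableSet.univ) fun p hp ↦ ?_)
  rw [Real.norm_eq_abs, abs_of_nonpos (psiDKernel_nonpos hu hf hf1 hp.1)]
  exact neg_psiDKernel_le hu le_rfl hf hf1 hp.1

end Integrated

theorem Admissible.isInwardField {γ b σ d κ kk : ℝ} {π ρm : Measure (ℝ × ℕ)}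
    (hadm : Admissible γ b σ d κ kk π ρm) :
    IsInwardField fun x ↦ (-PsiC γ σ κ π x.1 x.2, PsiD b d kk ρm x.1 x.2) := by
  obtain ⟨hb, hσ, hd, hκ, hkk, hπ0, hπ1, hρ0, hρ1⟩ := hadm
  have hwC := integrableOn_levelWeight (g := fun y ↦ min 1 (y ^ 2)) hπ0 hπ1
  have hwD := integrableOn_levelWeight (g := fun y ↦ min 1 y) hρ0 hρ1
  have hS : MeasurableSet (Ici (0 : ℝ) ×ˢ (univ : Set ℕ)) :=
    measurableSet_Ici.prod MeasurableSet.univ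
  set S := Ici (0 : ℝ) ×ˢ (univ : Set ℕ) with hSdef
  set wC := ∫ p in S, levelWeight (fun y ↦ min 1 (y ^ 2)) p ∂π
  set wD := ∫ p in S, levelWeight (fun y ↦ min 1 y) p ∂ρm
  have hwC0 : 0 ≤ wC := setIntegral_nonneg hS fun p _ ↦ by
    unfold levelWeight; split_ifs <;> positivity
  have hwD0 : 0 ≤ wD := setIntegral_nonneg hS fun p hp ↦ by
    have : 0 ≤ p.1 := hp.1
    unfold levelWeight; split_ifs <;> positivity
  have hC (u f : ℝ) : PsiC γ σ κ π u f =
      (∫ p in S, psiCKernel u f p ∂π) - γ * u + σ ^ 2 / 2 * u ^ 2 - κ := rfl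
  have hD (u f : ℝ) : PsiD b d kk ρm u f =
      (∫ p in S, psiDKernel u f p ∂ρm) - b * u * f + d * (1 - f) - kk * f := rfl
  constructor
  · intro ε M δ δ' hε hδ hδ'
    set c := M + 1 / ε + 1 + 1 / (1 - δ')
    set c' := M + 1 / ε + 2 + 1 / (1 - δ')
    set L := max (c * wC + |γ| + σ ^ 2 * M) (c' * wD + b + b * M + d + kk) with hL
    refine ⟨(2 * L).toNNReal, LipschitzOnWith.of_dist_le_mul ?_⟩
    rintro ⟨u, f⟩ ⟨hu, hf⟩ ⟨u', f'⟩ ⟨hu', hf'⟩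
    simp only at hu hf hu' hf'
    have hu0 := hε.trans_le hu.1
    have hu0' := hε.trans_le hu'.1
    have hf0 := hδ.trans_le hf.1
    have hf0' := hδ.trans_le hf'.1
    have hf1 := hf.2.trans_lt hδ'
    have hf1' := hf'.2.trans_lt hδ'
    have hM : 0 < M := hu0.trans_le hu.2
    have iC : |(∫ p in S, psiCKernel u f p ∂π) - ∫ p in S, psiCKernel u' f' p ∂π| ≤
        c * (|u - u'| + |f - f'|) * wC := by
      rw [← integral_sub (integrableOn_psiCKernel hwC hu0 hf0 hf1)
        (integrableOn_psiCKernel hwC hu0' hf0' hf1'), ← integral_const_mul, ← Real.norm_eq_abs]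
      refine norm_integral_le_of_norm_le (hwC.const_mul _) (ae_restrict_of_forall_mem hS
        fun p hp ↦ ?_)
      exact abs_psiCKernel_sub_le hε hδ hδ' hu hf hu' hf' hp.1
    have iD : |(∫ p in S, psiDKernel u f p ∂ρm) - ∫ p in S, psiDKernel u' f' p ∂ρm| ≤
        c' * (|u - u'| + |f - f'|) * wD := by
      rw [← integral_sub (integrableOn_psiDKernel hwD hu0 hf0 hf1)
        (integrableOn_psiDKernel hwD hu0' hf0' hf1'), ← integral_const_mul, ← Real.norm_eq_abs]
      refine norm_integral_le_of_norm_le (hwD.const_mul _) (ae_restrict_of_forall_mem hS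
        fun p hp ↦ ?_)
      exact abs_psiDKernel_sub_le hε hδ hδ' hu hf hu' hf' hp.1
    have hA := abs_nonneg (u - u')
    have hB := abs_nonneg (f - f')
    have hsq : |u ^ 2 - u' ^ 2| ≤ 2 * M * |u - u'| := by
      rw [sq_sub_sq, abs_mul, abs_of_pos (by linarith)]
      exact mul_le_mul_of_nonneg_right (by linarith [hu.2, hu'.2]) hA
    have hmul : |u * f - u' * f'| ≤ |u - u'| + M * |f - f'| := by
      calc |u * f - u' * f'| = |(u - u') * f + u' * (f - f')| := by ring_nf
        _ ≤ |u - u'| * |f| + |u'| * |f - f'| := by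
          rw [← abs_mul, ← abs_mul]
          exact abs_add_le _ _
        _ ≤ |u - u'| * 1 + M * |f - f'| := by
          rw [abs_of_pos hf0, abs_of_pos hu0']
          gcongr
          exact hu'.2
        _ = _ := by ring
    have dC : |(-PsiC γ σ κ π u f) - (-PsiC γ σ κ π u' f')| ≤ L * (|u - u'| + |f - f'|) := by
      calc _ = |-((∫ p in S, psiCKernel u f p ∂π) - ∫ p in S, psiCKernel u' f' p ∂π)
            + γ * (u - u') + -(σ ^ 2 / 2 * (u ^ 2 - u' ^ 2))| := by rw [hC, hC]; ring_nf
        _ ≤ c * (|u - u'| + |f - f'|) * wC + |γ| * |u - u'|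
            + σ ^ 2 / 2 * (2 * M * |u - u'|) := by
          refine (abs_add_le _ _).trans (add_le_add ((abs_add_le _ _).trans ?_) ?_)
          · rw [abs_neg, abs_mul]
            gcongr
          · rw [abs_neg, abs_mul, abs_of_nonneg (by positivity)]
            gcongr
        _ ≤ (c * wC + |γ| + σ ^ 2 * M) * (|u - u'| + |f - f'|) := by
          nlinarith [mul_nonneg (abs_nonneg γ) hB, mul_nonneg (mul_nonneg (sq_nonneg σ) hM.le) hB]
        _ ≤ _ := by
          gcongr
          exact le_max_left _ _
    have dD : |PsiD b d kk ρm u f - PsiD b d kk ρm u' f'| ≤ L * (|u - u'| + |f - f'|) := by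
      calc _ = |((∫ p in S, psiDKernel u f p ∂ρm) - ∫ p in S, psiDKernel u' f' p ∂ρm)
            + -(b * (u * f - u' * f')) + -((d + kk) * (f - f'))| := by rw [hD, hD]; ring_nf
        _ ≤ c' * (|u - u'| + |f - f'|) * wD + b * (|u - u'| + M * |f - f'|)
            + (d + kk) * |f - f'| := by
          refine (abs_add_le _ _).trans (add_le_add ((abs_add_le _ _).trans ?_) ?_)
          · rw [abs_neg, abs_mul, abs_of_nonneg hb]
            gcongr
          · rw [abs_neg, abs_mul, abs_of_nonneg (by positivity)]
        _ ≤ (c' * wD + b + b * M + d + kk) * (|u - u'| + |f - f'|) := by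
          nlinarith [mul_nonneg hb hB, mul_nonneg (mul_nonneg hb hM.le) hA, mul_nonneg hd hA,
            mul_nonneg hkk hA]
        _ ≤ _ := by
          gcongr
          exact le_max_right _ _
    have hL0 : 0 ≤ L := le_max_of_le_right <| by
      have : 0 < 1 / (1 - δ') := one_div_pos.2 (by linarith)
      positivity
    have hsum : |u - u'| + |f - f'| ≤ 2 * dist (u, f) (u', f') := by
      rw [Prod.dist_eq, Real.dist_eq, Real.dist_eq]
      linarith [le_max_left |u - u'| |f - f'|, le_max_right |u - u'| |f - f'|]
    rw [Real.coe_toNNReal _ (by positivity), mul_comm 2 L, mul_assoc]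
    refine le_trans ?_ (mul_le_mul_of_nonneg_left hsum hL0)
    exact max_le dC dD
  · refine ⟨wC + |γ| + κ, by positivity, fun u f hu hf hf1 ↦ ?_⟩
    have h : -(∫ p in S, psiCKernel u f p ∂π) ≤ wC := by
      rw [← integral_neg]
      exact setIntegral_mono_on (integrableOn_psiCKernel hwC hu hf hf1).neg hwC hS
        fun p hp ↦ neg_psiCKernel_le hu hf hf1 hp.1
    simp only [hC]
    nlinarith [mul_nonneg hwC0 hu.le, mul_nonneg hκ hu.le, abs_nonneg γ, le_abs_self γ,
      mul_nonneg (sq_nonneg σ) (sq_nonneg u)]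
  · refine fun M ↦ ⟨(M + 1) * wC + |γ| + σ ^ 2 * M, fun u f hu huM hf hf1 ↦ ?_⟩
    have h : ∫ p in S, psiCKernel u f p ∂π ≤ (M + 1) * u * wC := by
      rw [← integral_const_mul]
      exact setIntegral_mono_on (integrableOn_psiCKernel hwC hu hf hf1) (hwC.const_mul _) hS
        fun p hp ↦ psiCKernel_le hu huM hf hf1 hp.1
    have h2 : σ ^ 2 * u ^ 2 ≤ σ ^ 2 * (M * u) := by gcongr; nlinarith
    simp only [hC]
    nlinarith [neg_abs_le γ, mul_nonneg (sq_nonneg σ) (sq_nonneg u)]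
  · refine fun M ↦ ⟨(M + 1) * wD + b * M + kk, fun u f hu huM hf hf1 ↦ ?_⟩
    have h : -(∫ p in S, psiDKernel u f p ∂ρm) ≤ (M + 1) * f * wD := by
      rw [← integral_const_mul, ← integral_neg]
      exact setIntegral_mono_on (integrableOn_psiDKernel hwD hu hf hf1).neg (hwD.const_mul _) hS
        fun p hp ↦ neg_psiDKernel_le hu huM hf hf1 hp.1
    have h2 : b * u * f ≤ b * M * f := by gcongr
    simp only [hD]
    nlinarith
  · refine ⟨d, fun u f hu hf hf1 ↦ ?_⟩
    have h : ∫ p in S, psiDKernel u f p ∂ρm ≤ 0 :=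
      setIntegral_nonpos hS fun p hp ↦ psiDKernel_nonpos hu hf hf1 hp.1
    have h2 : 0 ≤ b * u * f := by positivity
    simp only [hD]
    nlinarith

/-- There is a unique global solution `t ↦ F_t = (u_t, f_t)` on `[0,∞)` of the system
`u̇ = −Ψ_c(u,f)`, `ḟ = Ψ_d(u,f)` with `F_0 = (q,r)`, and it satisfies
`0 < u_t < ∞` and `0 < f_t < 1` for every `t ≥ 0`. -/
theorem exists_unique_ode_solution
    (γ b σ d κ kk : ℝ) (π ρm : Measure (ℝ × ℕ))
    (hadm : Admissible γ b σ d κ kk π ρm)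
    (q r : ℝ) (hq : 0 < q) (hr : r ∈ Ioo (0 : ℝ) 1) :
    ∃ F : ℝ → ℝ × ℝ,
      (F 0 = (q, r) ∧
        (∀ t ∈ Ici (0 : ℝ), 0 < (F t).1 ∧ 0 < (F t).2 ∧ (F t).2 < 1) ∧
        (∀ t ∈ Ici (0 : ℝ),
          HasDerivWithinAt F
            (-PsiC γ σ κ π (F t).1 (F t).2, PsiD b d kk ρm (F t).1 (F t).2) (Ici 0) t)) ∧
      (∀ G : ℝ → ℝ × ℝ,
        (G 0 = (q, r) ∧
          (∀ t ∈ Ici (0 : ℝ), 0 < (G t).1 ∧ 0 < (G t).2 ∧ (G t).2 < 1) ∧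
          (∀ t ∈ Ici (0 : ℝ),
            HasDerivWithinAt G
              (-PsiC γ σ κ π (G t).1 (G t).2, PsiD b d kk ρm (G t).1 (G t).2) (Ici 0) t)) →
        ∀ t ∈ Ici (0 : ℝ), G t = F t) := by
  exact hadm.isInwardField.exists_unique_solution hq hr.1 hr.2
end
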